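/- Let B be the 12×12 real symmetric matrix defined as follows: b_ii = 1 for 1 ≤ i ≤ 6; b_ii = −2 for 7 ≤ i ≤ 9; b_ii = 0 for 10 ≤ i ≤ 12; b_{1,2} = b_{2,3} = b_{3,4} = b_{4,5} = b_{5,6} = b_{1,6} = −1; b_{1,7} = b_{4,7} = b_{2,8} = b_{5,8} = b_{3,9} = b_{6,9} = √2; b_{7,10} = b_{8,11} = b_{9,12} = 2; b_{10,11} = b_{10,12} = b_{11,12} = 1; and all other entries (and their symmetric counterparts determined by b_ij = b_ji) are 0. Then the spectrum of B is the multiset {−4, −4, −4, 0, 0, 0, 0, 0, 3, 3, 3, 3}, so the ordered multiplicity list of B is (3,5,4), and B has the Strong Multiplicity Property. -/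

import Mathlib

open Matrix

/-- The geometric multiplicity of `lam` as an eigenvalue of `A`:
`dim ker (A - lam • I)`. -/
noncomputable def multOf {m : Type*} [Fintype m] [DecidableEq m]
    (A : Matrix m m ℝ) (lam : ℝ) : ℕ :=
  Module.finrank ℝ (LinearMap.ker (A - lam • (1 : Matrix m m ℝ)).mulVecLin)

/-- The Strong Multiplicity Property for an `m × m` real symmetric matrix. -/
def HasSMP {m : ℕ} (A : Matrix (Fin m) (Fin m) ℝ) : Prop :=
  ∀ X : Matrix (Fin m) (Fin m) ℝ, X.IsSymm → Matrix.hadamard A X = 0 →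
    Matrix.hadamard (1 : Matrix (Fin m) (Fin m) ℝ) X = 0 → A * X - X * A = 0 →
    (∀ i : ℕ, 2 ≤ i → i ≤ m - 1 → (A ^ i * X).trace = 0) → X = 0

/-- The `12 × 12` symmetric matrix `B` of Proposition 4.2 (0-indexed): diagonal
`(1,1,1,1,1,1,-2,-2,-2,0,0,0)`, entries `-1` on the 6-cycle `0⋯5`, `√2` joining
the cycle to vertices `6,7,8`, `2` joining `6,7,8` to `9,10,11`, and `1` on the
triangle `{9,10,11}`. -/
noncomputable def matB : Matrix (Fin 12) (Fin 12) ℝ :=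
  Matrix.of fun i j =>
    if i = j then (if i.val ≤ 5 then 1 else if i.val ≤ 8 then -2 else 0)
    else
      if (min i.val j.val, max i.val j.val) ∈
          [(0,1), (1,2), (2,3), (3,4), (4,5), (0,5)] then -1
      else if (min i.val j.val, max i.val j.val) ∈
          [(0,6), (3,6), (1,7), (4,7), (2,8), (5,8)] then Real.sqrt 2
      else if (min i.val j.val, max i.val j.val) ∈ [(6,9), (7,10), (8,11)] then 2
      else if (min i.val j.val, max i.val j.val) ∈ [(9,10), (9,11), (10,11)] then 1
      else 0

/-- A rational form of `matB`: conjugating `matB` by `diagonal scaleB` gives this integer matrix. -/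
def intB : Matrix (Fin 12) (Fin 12) ℤ :=
  !![1, -1, 0, 0, 0, -1, 2, 0, 0, 0, 0, 0;
     -1, 1, -1, 0, 0, 0, 0, 2, 0, 0, 0, 0;
     0, -1, 1, -1, 0, 0, 0, 0, 2, 0, 0, 0;
     0, 0, -1, 1, -1, 0, 2, 0, 0, 0, 0, 0;
     0, 0, 0, -1, 1, -1, 0, 2, 0, 0, 0, 0;
     -1, 0, 0, 0, -1, 1, 0, 0, 2, 0, 0, 0;
     1, 0, 0, 1, 0, 0, -2, 0, 0, 2, 0, 0;
     0, 1, 0, 0, 1, 0, 0, -2, 0, 0, 2, 0;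
     0, 0, 1, 0, 0, 1, 0, 0, -2, 0, 0, 2;
     0, 0, 0, 0, 0, 0, 2, 0, 0, 0, 1, 1;
     0, 0, 0, 0, 0, 0, 0, 2, 0, 1, 0, 1;
     0, 0, 0, 0, 0, 0, 0, 0, 2, 1, 1, 0]

/-- The integer matrix similar to `matB`, over `ℝ`. -/
noncomputable def realB : Matrix (Fin 12) (Fin 12) ℝ := intB.map (Int.cast : ℤ → ℝ)

/-- Diagonal of the matrix conjugating `matB` to `realB`. -/
noncomputable def scaleB (i : Fin 12) : ℝ := if i.val ≤ 5 then Real.sqrt 2 else 1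

theorem scaleB_ne_zero (i : Fin 12) : scaleB i ≠ 0 := by
  unfold scaleB; split_ifs <;> simp

set_option maxHeartbeats 1000000 in
theorem diagonal_scaleB_mul_matB :
    diagonal scaleB * matB = realB * diagonal scaleB := by
  have h : Real.sqrt 2 * Real.sqrt 2 = 2 := Real.mul_self_sqrt (by norm_num)
  rw [← Matrix.ext_iff]
  simp only [Matrix.diagonal_mul, Matrix.mul_diagonal]
  simp [Fin.forall_fin_succ, realB, matB, scaleB, intB, h]

theorem isUnit_det_diagonal_scaleB : IsUnit (diagonal scaleB).det := by
  simp [Matrix.det_diagonal, Finset.prod_ne_zero_iff, scaleB_ne_zero]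

theorem matB_eq :
    matB = (diagonal scaleB)⁻¹ * realB * diagonal scaleB := by
  rw [mul_assoc, ← diagonal_scaleB_mul_matB,
    Matrix.nonsing_inv_mul_cancel_left _ _ isUnit_det_diagonal_scaleB]

theorem matB_isSymm : matB.IsSymm := by
  ext i j
  by_cases h : i = j
  · rw [h, transpose_apply]
  · simp only [matB, transpose_apply, of_apply, h, Ne.symm h, if_false, min_comm j.val,
      max_comm j.val]

theorem realB_mul_realB : realB * realB = (intB * intB).map (Int.cast : ℤ → ℝ) :=
  (Matrix.map_mul (f := Int.castRingHom ℝ)).symm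

theorem realB_cube : realB * realB * realB = 12 • realB - realB * realB := by
  have h : intB * intB * intB = 12 • intB - intB * intB := by decide +kernel
  have hR := congrArg (Int.castRingHom ℝ).mapMatrix h
  simp only [map_sub, map_nsmul, map_mul] at hR
  exact hR

theorem matB_mul_matB :
    matB * matB = (diagonal scaleB)⁻¹ * (realB * realB) * diagonal scaleB := by
  simp only [matB_eq, mul_assoc,
    Matrix.mul_nonsing_inv_cancel_left _ _ isUnit_det_diagonal_scaleB]

theorem matB_cube : matB * (matB * matB) = (12 : ℝ) • matB - matB * matB := by
  have h : matB * (matB * matB) =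
      (diagonal scaleB)⁻¹ * (realB * realB * realB) * diagonal scaleB := by
    simp only [matB_eq, mul_assoc,
      Matrix.mul_nonsing_inv_cancel_left _ _ isUnit_det_diagonal_scaleB]
  rw [h, realB_cube, matB_mul_matB, ← Nat.cast_smul_eq_nsmul ℝ, Nat.cast_ofNat, mul_sub, sub_mul,
    Matrix.mul_smul, Matrix.smul_mul, ← matB_eq]

theorem trace_conj_diagonal_scaleB (R : Matrix (Fin 12) (Fin 12) ℝ) :
    ((diagonal scaleB)⁻¹ * R * diagonal scaleB).trace = R.trace := by
  rw [Matrix.trace_mul_comm, Matrix.mul_nonsing_inv_cancel_left _ _ isUnit_det_diagonal_scaleB]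

theorem trace_matB : matB.trace = 0 := by
  have h : intB.trace = 0 := by decide +kernel
  rw [matB_eq, trace_conj_diagonal_scaleB, realB]
  exact (AddMonoidHom.map_trace (Int.castAddHom ℝ) intB).symm.trans (by simp [h])

theorem trace_matB_mul_matB : (matB * matB).trace = 84 := by
  have h : (intB * intB).trace = 84 := by decide +kernel
  rw [matB_mul_matB, trace_conj_diagonal_scaleB, realB_mul_realB]
  exact (AddMonoidHom.map_trace (Int.castAddHom ℝ) _).symm.trans (by simp [h])

theorem multOf_eq_trace {m : Type*} [Fintype m] [DecidableEq m] {A P Q : Matrix m m ℝ} {t : ℝ}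
    (hP : (A - t • 1) * P = 0) (hQ : P = 1 + Q * (A - t • 1)) : (multOf A t : ℝ) = P.trace := by
  have hproj : LinearMap.IsProj (LinearMap.ker (A - t • (1 : Matrix m m ℝ)).mulVecLin)
      P.mulVecLin := by
    refine ⟨fun v => ?_, fun v hv => ?_⟩
    · rw [LinearMap.mem_ker, Matrix.mulVecLin_apply, Matrix.mulVecLin_apply, Matrix.mulVec_mulVec,
        hP, Matrix.zero_mulVec]
    · rw [LinearMap.mem_ker, Matrix.mulVecLin_apply] at hv
      rw [hQ, Matrix.mulVecLin_apply, Matrix.add_mulVec, ← Matrix.mulVec_mulVec, hv]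
      simp
  rw [← Matrix.trace_toLin'_eq, Matrix.toLin'_apply', hproj.trace, multOf]

theorem realB_mul (Z : Matrix (Fin 12) (Fin 12) ℝ) :
    realB * Z = Matrix.of ![
      Z 0 + 2 • Z 6 - Z 1 - Z 5,
      Z 1 + 2 • Z 7 - Z 0 - Z 2,
      Z 2 + 2 • Z 8 - Z 1 - Z 3,
      Z 3 + 2 • Z 6 - Z 2 - Z 4,
      Z 4 + 2 • Z 7 - Z 3 - Z 5,
      Z 5 + 2 • Z 8 - Z 0 - Z 4,
      Z 0 + Z 3 + 2 • Z 9 - 2 • Z 6,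
      Z 1 + Z 4 + 2 • Z 10 - 2 • Z 7,
      Z 2 + Z 5 + 2 • Z 11 - 2 • Z 8,
      2 • Z 6 + Z 10 + Z 11,
      2 • Z 7 + Z 9 + Z 11,
      2 • Z 8 + Z 9 + Z 10] := by
  ext i j
  fin_cases i <;> simp [Matrix.mul_apply, Fin.sum_univ_succ, realB, intB] <;> ring

set_option maxHeartbeats 2000000 in
theorem eq_zero_of_isSymm (Z : Matrix (Fin 12) (Fin 12) ℝ) (hZ : Z.IsSymm)
    (hBZ : (realB * Z).IsSymm) (hzero : ∀ i j, (i = j ∨ intB i j ≠ 0) → Z i j = 0)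
    (htr : ∑ i, (realB * (realB * Z)) i i * (if i.val ≤ 5 then 1 else 2) = 0) : Z = 0 := by
  have hsymm : ∀ i j, i < j → Z j i = Z i j := fun i j _ => hZ.apply i j
  have hcomm : ∀ i j, i < j → (realB * Z) j i = (realB * Z) i j := fun i j _ => hBZ.apply i j
  simp only [realB_mul] at hcomm htr
  simp [Fin.forall_fin_succ, intB] at hzero
  simp [Fin.forall_fin_succ, hzero] at hsymm
  simp [Fin.forall_fin_succ, hzero, hsymm] at hcomm
  simp [Fin.sum_univ_succ, hzero, hsymm] at htr
  suffices h : ∀ i j, Z i j = 0 from Matrix.ext h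
  simp [Fin.forall_fin_succ, hzero, hsymm]
  clear hzero hsymm
  grind (splits := 60)

theorem hasSMP_matB : HasSMP matB := by
  intro X hX hBX hIX hcomm htr
  have hZ : ∀ i j, (diagonal scaleB * X * diagonal scaleB) i j = scaleB i * X i j * scaleB j := by
    intro i j
    rw [Matrix.mul_diagonal, Matrix.diagonal_mul]
  have hRZ : ∀ Y, realB * (diagonal scaleB * Y * diagonal scaleB) =
      diagonal scaleB * (matB * Y) * diagonal scaleB := by
    intro Y
    simp only [← mul_assoc, diagonal_scaleB_mul_matB]
  have hzero : diagonal scaleB * X * diagonal scaleB = 0 := by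
    apply eq_zero_of_isSymm
    · simp [Matrix.IsSymm, hX.eq, mul_assoc]
    · rw [hRZ, sub_eq_zero.mp hcomm]
      simp only [Matrix.IsSymm, transpose_mul, diagonal_transpose, hX.eq, matB_isSymm.eq,
        ← mul_assoc]
      rw [mul_assoc _ matB, sub_eq_zero.mp hcomm, ← mul_assoc]
    · rintro i j (rfl | hij)
      · have := congrFun₂ hIX i i
        simp_all
      · have h := congrFun₂ diagonal_scaleB_mul_matB i j
        rw [Matrix.diagonal_mul, Matrix.mul_diagonal] at h
        have hB : matB i j ≠ 0 := by
          intro h0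
          simp [h0, scaleB_ne_zero, realB, hij] at h
        have := congrFun₂ hBX i j
        simp_all
    · have h2 := htr 2 le_rfl (by norm_num)
      rw [pow_two, mul_assoc] at h2
      have hs : ∀ i, scaleB i * scaleB i * (if i.val ≤ 5 then 1 else 2) = 2 := by
        intro i
        unfold scaleB
        split_ifs <;> norm_num
      calc _ = ∑ i, 2 * (matB * (matB * X)) i i := by
            refine Finset.sum_congr rfl fun i _ => ?_
            rw [hRZ, hRZ, Matrix.mul_diagonal, Matrix.diagonal_mul, mul_right_comm (scaleB i),
              mul_right_comm, hs]
        _ = 0 := by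
            rw [← Finset.mul_sum]
            exact mul_eq_zero_of_right _ h2
  ext i j
  have h := hZ i j
  rw [hzero] at h
  simpa [scaleB_ne_zero] using h.symm

/-- `matB` has spectrum `{-4,-4,-4,0,0,0,0,0,3,3,3,3}` (ordered multiplicity
list `(3,5,4)`) and has the SMP. -/
theorem matB_spectrum_and_SMP :
    multOf matB (-4) = 3 ∧ multOf matB 0 = 5 ∧ multOf matB 3 = 4 ∧
    (∀ t : ℝ, t ≠ -4 → t ≠ 0 → t ≠ 3 → multOf matB t = 0) ∧
    HasSMP matB := by
  refine ⟨?_, ?_, ?_, fun t h₁ h₂ h₃ => ?_, hasSMP_matB⟩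
  · have h := multOf_eq_trace (A := matB) (t := -4)
      (P := (1 / 28 : ℝ) • (matB * matB - (3 : ℝ) • matB))
      (Q := (1 / 28 : ℝ) • (matB - (7 : ℝ) • 1))
      (by simp only [mul_smul_comm, smul_mul_assoc, sub_mul, mul_sub, one_mul, matB_cube]; module)
      (by simp only [mul_smul_comm, smul_mul_assoc, sub_mul, mul_sub, one_mul, mul_one]; module)
    norm_num [trace_matB, trace_matB_mul_matB] at h
    exact_mod_cast h
  · have h := multOf_eq_trace (A := matB) (t := 0)
      (P := 1 - (1 / 12 : ℝ) • (matB * matB + matB))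
      (Q := (-1 / 12 : ℝ) • (matB + 1))
      (by simp only [mul_smul_comm, smul_mul_assoc, sub_mul, mul_sub, mul_add, one_mul, mul_one,
        matB_cube]; module)
      (by simp only [mul_smul_comm, smul_mul_assoc, add_mul, mul_sub, one_mul, mul_one]; module)
    norm_num [trace_matB, trace_matB_mul_matB] at h
    exact_mod_cast h
  · have h := multOf_eq_trace (A := matB) (t := 3)
      (P := (1 / 21 : ℝ) • (matB * matB + (4 : ℝ) • matB))
      (Q := (1 / 21 : ℝ) • (matB + (7 : ℝ) • 1))
      (by simp only [mul_smul_comm, smul_mul_assoc, sub_mul, mul_add, one_mul, matB_cube]; module)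
      (by simp only [mul_smul_comm, smul_mul_assoc, add_mul, mul_sub, one_mul, mul_one]; module)
    norm_num [trace_matB, trace_matB_mul_matB] at h
    exact_mod_cast h
  · have hp : t * (t + 4) * (t - 3) ≠ 0 :=
      mul_ne_zero (mul_ne_zero h₂ (by rwa [ne_eq, add_eq_zero_iff_eq_neg])) (sub_ne_zero.mpr h₃)
    have h := multOf_eq_trace (A := matB) (t := t) (P := 0)
      (Q := (t * (t + 4) * (t - 3))⁻¹ •
        (matB * matB + (t + 1) • matB + (t ^ 2 + t - 12) • 1))
      (mul_zero _) (by
        have hq : (matB * matB + (t + 1) • matB + (t ^ 2 + t - 12) • 1) * (matB - t • 1) =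
            -(t * (t + 4) * (t - 3)) • 1 := by
          simp only [mul_smul_comm, smul_mul_assoc, add_mul, mul_sub, one_mul, mul_one, mul_assoc,
            matB_cube]
          module
        rw [smul_mul_assoc, hq, neg_smul, smul_neg, inv_smul_smul₀ hp, add_neg_cancel])
    simpa using h
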